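/- Let G be a finite simple graph on n vertices with no isolated vertices (minimum degree at least one). Then ir(G) ≤ n/2; consequently, for every positive integer k with 2k ≤ n, G has a maximal irredundant set of cardinality at most n − k. -/

import Mathlib

/-- A set `I` of vertices is *irredundant* in `G` if every `v ∈ I` either has no
neighbor in `I`, or has a private neighbor: a vertex `u ∉ I` adjacent to `v`
whose only neighbor in `I` is `v`. -/
def Irredundant {V : Type*} (G : SimpleGraph V) (I : Set V) : Prop :=
  ∀ v ∈ I, (∀ u ∈ I, ¬ G.Adj v u) ∨
    ∃ u, u ∉ I ∧ G.Adj u v ∧ ∀ w ∈ I, G.Adj u w → w = v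

/-- An irredundant set is *maximal* if no proper superset of it is irredundant. -/
def MaximalIrredundant {V : Type*} (G : SimpleGraph V) (I : Set V) : Prop :=
  Irredundant G I ∧ ∀ J : Set V, I ⊂ J → ¬ Irredundant G J

/-- `ir(G)`: the minimum cardinality of a maximal irredundant set. -/
noncomputable def irLower {V : Type*} [Fintype V] (G : SimpleGraph V) : ℕ :=
  sInf {n | ∃ I : Set V, MaximalIrredundant G I ∧ I.ncard = n}

/-- A set `D` of vertices is *dominating* in `G` if every vertex outside `D` has a neighbor
in `D`. -/
def Dominating {V : Type*} (G : SimpleGraph V) (D : Set V) : Prop :=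
  ∀ u ∉ D, ∃ w ∈ D, G.Adj u w

theorem irredundant_of_minimal_dominating {V : Type*} {G : SimpleGraph V} {D : Set V}
    (hD : Minimal (Dominating G) D) : Irredundant G D := by
  intro v hv
  have hnot : ¬ Dominating G (D \ {v}) := fun h => (hD.2 h Set.sdiff_subset hv).2 rfl
  unfold Dominating at hnot
  push Not at hnot
  obtain ⟨u, hu, hadj⟩ := hnot
  have huniq : ∀ w ∈ D, G.Adj u w → w = v := fun w hw h => by
    by_contra hne
    exact hadj w ⟨hw, hne⟩ h
  by_cases huD : u ∈ D
  · obtain rfl : u = v := by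
      by_contra hne
      exact hu ⟨huD, hne⟩
    exact Or.inl fun w hw h => h.ne (huniq w hw h).symm
  · obtain ⟨w, hw, h⟩ := hD.1 u huD
    exact Or.inr ⟨u, huD, huniq w hw h ▸ h, huniq⟩

theorem Dominating.not_irredundant_of_ssubset {V : Type*} {G : SimpleGraph V} {D J : Set V}
    (hD : Dominating G D) (hDJ : D ⊂ J) : ¬ Irredundant G J := by
  intro hJ
  obtain ⟨x, hxJ, hxD⟩ := Set.exists_of_ssubset hDJ
  rcases hJ x hxJ with h | ⟨u, huJ, -, huniq⟩
  · obtain ⟨w, hw, hadj⟩ := hD x hxD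
    exact h w (hDJ.subset hw) hadj
  · obtain ⟨w, hw, hadj⟩ := hD u fun hu => huJ (hDJ.subset hu)
    exact hxD (huniq w (hDJ.subset hw) hadj ▸ hw)

theorem maximalIrredundant_of_minimal_dominating {V : Type*} {G : SimpleGraph V} {D : Set V}
    (hD : Minimal (Dominating G) D) : MaximalIrredundant G D :=
  ⟨irredundant_of_minimal_dominating hD, fun _ => hD.1.not_irredundant_of_ssubset⟩

theorem Irredundant.dominating_compl {V : Type*} {G : SimpleGraph V} {I : Set V}
    (hmin : ∀ v : V, ∃ u : V, G.Adj v u) (hI : Irredundant G I) : Dominating G Iᶜ := by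
  intro v hv
  rcases hI v (not_not.mp hv) with h | ⟨u, hu, hadj, -⟩
  · obtain ⟨u, hadj⟩ := hmin v
    exact ⟨u, fun hu => h u hu hadj, hadj⟩
  · exact ⟨u, hu, hadj.symm⟩

theorem exists_maximalIrredundant_two_mul_ncard_le {V : Type*} [Fintype V] (G : SimpleGraph V)
    (hmin : ∀ v : V, ∃ u : V, G.Adj v u) :
    ∃ I : Set V, MaximalIrredundant G I ∧ 2 * I.ncard ≤ Fintype.card V := by
  obtain ⟨D, hD, hcard⟩ := Set.exists_min_image {D : Set V | Dominating G D} Set.ncard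
    (Set.toFinite _) ⟨Set.univ, fun u hu => (hu trivial).elim⟩
  have hDmin : Minimal (Dominating G) D :=
    ⟨hD, fun E hE hED => (Set.eq_of_subset_of_ncard_le hED (hcard E hE)).symm.subset⟩
  have hmax := maximalIrredundant_of_minimal_dominating hDmin
  refine ⟨D, hmax, ?_⟩
  have hle := hcard Dᶜ (hmax.1.dominating_compl hmin)
  have hsum := Set.ncard_add_ncard_compl D
  rw [Nat.card_eq_fintype_card] at hsum
  omega

/-- if `G` has no isolated vertices then `ir(G) ≤ n/2`; consequently,
for every positive integer `k` with `2k ≤ n`, `G` has a maximal irredundant set of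
cardinality at most `n − k`. -/
theorem irLower_le_half {V : Type*} [Fintype V] (G : SimpleGraph V)
    (hmin : ∀ v : V, ∃ u : V, G.Adj v u) :
    2 * irLower G ≤ Fintype.card V ∧
    ∀ k : ℕ, 0 < k → 2 * k ≤ Fintype.card V →
      ∃ I : Set V, MaximalIrredundant G I ∧ I.ncard ≤ Fintype.card V - k := by
  obtain ⟨I, hI, hcard⟩ := exists_maximalIrredundant_two_mul_ncard_le G hmin
  have hle : irLower G ≤ I.ncard := Nat.sInf_le ⟨I, hI, rfl⟩
  exact ⟨by omega, fun k _ hk => ⟨I, hI, by omega⟩⟩
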